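/- Let S = (s_1, s_2, …) be a sequence of integers each ≥ 2, let n ≥ 2, and let X be a closed T_n-invariant subset of (ℤ/nℤ)^ℤ such that (X, T_n restricted to X) is topologically conjugate to the S-adic odometer (Z̃(S), +1̃). Then for every x ∈ X and every i ∈ ℤ, column i of the space-time diagram of T_n with seed x is periodic. -/

import Mathlib

instance (n : ℕ) : TopologicalSpace (ZMod n) := ⊥
instance (n : ℕ) : DiscreteTopology (ZMod n) := ⟨rfl⟩

/-- `odProd S k = s₁ s₂ ⋯ s_{k+1}` (where `S i = s_{i+1}`, i.e. `S 0 = s₁`). -/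
def odProd (S : ℕ → ℕ) (k : ℕ) : ℕ := ∏ i ∈ Finset.range (k + 1), S i

theorem odProd_dvd (S : ℕ → ℕ) (k : ℕ) : odProd S k ∣ odProd S (k + 1) := by
  have h : odProd S (k + 1) = odProd S k * S (k + 1) := Finset.prod_range_succ S (k + 1)
  rw [h]
  exact dvd_mul_right _ _

/-- `Z̃(S)`: the inverse limit of the cyclic groups `ℤ/(s₁⋯s_k)ℤ` under the
binding maps `z ↦ z mod s₁⋯s_k`, with its profinite (subspace-of-product)
topology. -/
def OdometerSpace (S : ℕ → ℕ) : Type :=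
  { z : (k : ℕ) → ZMod (odProd S k) //
      ∀ k, ZMod.castHom (odProd_dvd S k) (ZMod (odProd S k)) (z (k + 1)) = z k }

instance (S : ℕ → ℕ) : TopologicalSpace (OdometerSpace S) :=
  inferInstanceAs (TopologicalSpace
    { z : (k : ℕ) → ZMod (odProd S k) //
        ∀ k, ZMod.castHom (odProd_dvd S k) (ZMod (odProd S k)) (z (k + 1)) = z k })

/-- The `+1̃` map on the odometer: add `1` in every coordinate. -/
def odometerAddOne (S : ℕ → ℕ) (z : OdometerSpace S) : OdometerSpace S :=
  ⟨fun k => z.1 k + 1, fun k => by rw [map_add, map_one, z.2 k]⟩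

/-- The two-sided cellular automaton `T_n` on `(ℤ/nℤ)^ℤ` with local rule
`xᵢ ↦ xᵢ + xᵢ₊₁ (mod n)`. -/
def Tca (n : ℕ) (x : ℤ → ZMod n) : ℤ → ZMod n := fun i => x i + x (i + 1)

/-- Column `i` of the space-time diagram of `T_n` with seed `x`:
`j ↦ [T_n^j(x)]_i`. -/
def col (n : ℕ) (x : ℤ → ZMod n) (i : ℤ) : ℕ → ZMod n := fun j => (Tca n)^[j] x i

/-- A sequence `f : ℕ → α` is periodic with least period `m`. -/
def HasLeastPeriod {α : Type*} (f : ℕ → α) (m : ℕ) : Prop :=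
  0 < m ∧ (∀ j, f (j + m) = f j) ∧ ∀ m', 0 < m' → (∀ j, f (j + m') = f j) → m ≤ m'

theorem OdometerSpace.coord_eq_of_le {S : ℕ → ℕ} {w z : OdometerSpace S} {i k : ℕ} (hik : i ≤ k)
    (hk : w.1 k = z.1 k) : w.1 i = z.1 i := by
  induction k, hik using Nat.le_induction with
  | base => exact hk
  | succ k _ ih => exact ih (by rw [← w.2 k, ← z.2 k, hk])

theorem OdometerSpace.continuous_coord (S : ℕ → ℕ) (k : ℕ) :
    Continuous fun z : OdometerSpace S => z.1 k :=
  (continuous_apply k).comp continuous_subtype_val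

/-- Every open neighbourhood in the odometer contains a cylinder. -/
theorem OdometerSpace.exists_cylinder_subset {S : ℕ → ℕ} {U : Set (OdometerSpace S)}
    (hU : IsOpen U) {z : OdometerSpace S} (hz : z ∈ U) :
    ∃ k, ∀ w : OdometerSpace S, w.1 k = z.1 k → w ∈ U := by
  obtain ⟨V, hV, rfl⟩ := isOpen_induced_iff.1 hU
  obtain ⟨I, u, hu, hI⟩ := isOpen_pi_iff.1 hV z.1 hz
  refine ⟨I.sup id, fun w hw => hI fun i hi => ?_⟩
  have hwi : w.1 i = z.1 i := OdometerSpace.coord_eq_of_le (Finset.le_sup (f := id) hi) hw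
  exact hwi.symm ▸ (hu i hi).2

/-- A continuous map from a compact odometer to a discrete space depends on one coordinate only. -/
theorem OdometerSpace.exists_factors_coord {S : ℕ → ℕ} [CompactSpace (OdometerSpace S)]
    {α : Type*} [TopologicalSpace α] [DiscreteTopology α] {f : OdometerSpace S → α}
    (hf : Continuous f) :
    ∃ k, ∀ w z : OdometerSpace S, w.1 k = z.1 k → f w = f z := by
  let V : ℕ → Set (OdometerSpace S) := fun k => {z | ∀ w, w.1 k = z.1 k → f w = f z}
  have hVo : ∀ k, IsOpen (V k) := fun k => by
    refine isOpen_iff_forall_mem_open.2 fun z hz =>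
      ⟨(fun w : OdometerSpace S => w.1 k) ⁻¹' {z.1 k}, fun w hw v hv => ?_,
        (isOpen_discrete _).preimage (OdometerSpace.continuous_coord S k), rfl⟩
    exact (hz v (hv.trans hw)).trans (hz w hw).symm
  have hVm : Monotone V := fun k l hkl z hz w hw =>
    hz w (OdometerSpace.coord_eq_of_le hkl hw)
  have hVc : Set.univ ⊆ ⋃ k, V k := fun z _ => by
    obtain ⟨k, hk⟩ := OdometerSpace.exists_cylinder_subset
      ((isOpen_discrete {f z}).preimage hf) (z := z) rfl
    exact Set.mem_iUnion.2 ⟨k, hk⟩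
  obtain ⟨k, hk⟩ := isCompact_univ.elim_directed_cover V hVo hVc hVm.directed_le
  exact ⟨k, fun w z hwz => hk (Set.mem_univ z) w hwz⟩

theorem odometerAddOne_iterate_coord (S : ℕ → ℕ) (m : ℕ) (z : OdometerSpace S) (k : ℕ) :
    ((odometerAddOne S)^[m] z).1 k = z.1 k + m := by
  induction m with
  | zero => simp
  | succ m ih =>
    rw [Function.iterate_succ_apply', Nat.cast_succ, ← add_assoc, ← ih]
    rfl

/-- If `X` is a closed `T_n`-invariant set such that `(X, T_n|_X)` is
topologically conjugate to the `S`-adic odometer, then for every `x ∈ X` every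
column of the space-time diagram of `T_n` with seed `x` is periodic. -/
theorem columns_periodic_of_conj_odometer (S : ℕ → ℕ) (hS : ∀ k, 2 ≤ S k)
    (n : ℕ) (hn : 2 ≤ n) (X : Set (ℤ → ZMod n)) (hXc : IsClosed X)
    (hXi : Set.MapsTo (Tca n) X X) (h : OdometerSpace S ≃ₜ X)
    (hconj : ∀ z, (h (odometerAddOne S z) : ℤ → ZMod n) = Tca n (h z)) :
    ∀ x ∈ X, ∀ i : ℤ, ∃ m, 0 < m ∧ ∀ j, col n x i (j + m) = col n x i j := by
  intro x hx i
  have : NeZero n := ⟨by omega⟩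
  have : CompactSpace X := isCompact_iff_compactSpace.1 hXc.isCompact
  have : CompactSpace (OdometerSpace S) := h.symm.compactSpace
  have hcont : Continuous fun z => (h z : ℤ → ZMod n) i :=
    (continuous_apply i).comp (continuous_subtype_val.comp h.continuous)
  obtain ⟨k, hk⟩ := OdometerSpace.exists_factors_coord hcont
  have hiter : ∀ j z, (h ((odometerAddOne S)^[j] z) : ℤ → ZMod n) = (Tca n)^[j] (h z) :=
    fun j => Function.Semiconj.iterate_right (f := fun z => (h z : ℤ → ZMod n)) hconj j
  obtain ⟨z, hz⟩ := h.surjective ⟨x, hx⟩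
  have hxz : x = h z := by rw [hz]
  refine ⟨odProd S k, Finset.prod_pos fun i _ => by linarith [hS i], fun j => ?_⟩
  simp only [col, hxz, ← hiter]
  apply hk
  simp [odometerAddOne_iterate_coord]
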